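/- Let g ≥ 1 and let 0 ≤ i ≤ ⌊g/2⌋. Let x be an extended alcove for GSp_{2g} such that x_i = τ_i and x_{g−i} = τ_{g−i}, where τ is the distinguished extended alcove given by τ_m = (0^{(g+m)}, 1^{(g−m)}) for 0 ≤ m ≤ g. Then x is μ-permissible, i.e. ω_m(j) ≤ x_m(j) ≤ ω_m(j) + 1 for all m ∈ {0,…,2g−1} and all j, and Σ_j x_m(j) = g − m for all m. (These alcoves are precisely the ones indexing the i-superspecial Kottwitz–Rapoport strata.) -/

import Mathlib

open Finset

/-- Elements of `ℤⁿ`; the coordinate `v(j)` for `1 ≤ j ≤ n` is `v ⟨j-1, _⟩`. -/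
abbrev Vec (n : ℕ) := Fin n → ℤ

/-- The extension of a tuple `(x_0, …, x_{n-1})` by `x_n := x_0 - (1,…,1)`. -/
def xext (n : ℕ) [NeZero n] (x : Fin n → Vec n) (m : ℕ) : Vec n :=
  if h : m < n then x ⟨m, h⟩ else fun j => x ⟨0, Nat.pos_of_ne_zero (NeZero.ne n)⟩ j - 1

/-- An extended alcove for `GL_n`: setting `x_n := x_0 - (1,…,1)`, for each
`i ∈ {0,…,n-1}` there is exactly one coordinate `j` with `x_{i+1}(j) = x_i(j) - 1`,
and `x_{i+1}(j') = x_i(j')` for all other coordinates `j'`. -/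
def IsExtendedAlcove (n : ℕ) [NeZero n] (x : Fin n → Vec n) : Prop :=
  ∀ i : Fin n, ∃! j : Fin n,
    xext n x ((i : ℕ) + 1) j = xext n x (i : ℕ) j - 1 ∧
      ∀ j' : Fin n, j' ≠ j → xext n x ((i : ℕ) + 1) j' = xext n x (i : ℕ) j'

/-- The standard alcove `ω`: `ω_i(j) = -1` for `j ≤ i` and `ω_i(j) = 0` for `j > i`
(coordinates `j ∈ {1,…,n}`). -/
def stdAlc (n : ℕ) (i : ℕ) : Vec n := fun j => if (j : ℕ) + 1 ≤ i then -1 else 0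

/-- `μ`-permissibility for `μ = (1^{(r)}, 0^{(n-r)})`:
`ω_i ≤ x_i ≤ ω_i + (1,…,1)` componentwise, and `Σ_j x_i(j) = n - r - i`. -/
def IsMuPermissible (n : ℕ) (r : ℕ) (x : Fin n → Vec n) : Prop :=
  ∀ i : Fin n,
    (∀ j, stdAlc n (i : ℕ) j ≤ x i j ∧ x i j ≤ stdAlc n (i : ℕ) j + 1) ∧
    (∑ j, x i j) = (n : ℤ) - (r : ℤ) - ((i : ℕ) : ℤ)

/-- The cyclic interval `(j, i] = {j+1, j+2, …, i} ⊆ ℤ/nℤ`; it is all of `ℤ/nℤ` when `i = j`. -/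
def cycInt (n : ℕ) [NeZero n] (j i : ZMod n) : Finset (ZMod n) :=
  (Finset.Icc 1 (if i = j then n else (i - j).val)).image fun m : ℕ => j + (m : ZMod n)

/-- The `Fin n`-index of the coordinate `∈ {1,…,n}` representing the residue `k ∈ ℤ/nℤ`. -/
def toIdx (n : ℕ) [NeZero n] (k : ZMod n) : Fin n := ⟨(k - 1).val, ZMod.val_lt _⟩

/-- The invariant `r_{ij}(x) = Σ_{k ∈ (j,i]} (ω_i(k) - x_i(k) + 1)` for residues
`i, j ∈ ℤ/nℤ`, the subscript `i` being taken via its representative in `{0,…,n-1}`. -/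
def rInv (n : ℕ) [NeZero n] (x : Fin n → Vec n) (i j : ZMod n) : ℤ :=
  ∑ k ∈ cycInt n j i,
    (stdAlc n i.val (toIdx n k) - x ⟨i.val, ZMod.val_lt i⟩ (toIdx n k) + 1)

/-- The duality condition defining extended alcoves for `GSp_n` (`n = 2g`):
`x_i(j) + x_{n-i}(n-j+1) = c - 1` for all `0 ≤ i ≤ n` and coordinates `j ∈ {1,…,n}`,
where `x_n := x_0 - (1,…,1)`.  (An extended alcove for `GSp_{2g}` is an extended
alcove for `GL_{2g}` satisfying this condition for some constant `c = c(x)`.) -/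
def IsSympDual (n : ℕ) [NeZero n] (x : Fin n → Vec n) (c : ℤ) : Prop :=
  ∀ i : ℕ, i ≤ n → ∀ j : Fin n, xext n x i j + xext n x (n - i) j.rev = c - 1

/-- The distinguished extended alcove `τ`: `τ_m = (0^{(g+m)}, 1^{(g-m)})` for `0 ≤ m ≤ g`. -/
def tauAlc (g : ℕ) (m : ℕ) : Vec (2 * g) := fun j => if (j : ℕ) + 1 ≤ g + m then 0 else 1

lemma xext_step (n : ℕ) [NeZero n] (x : Fin n → Vec n) (h : IsExtendedAlcove n x)
    (m : ℕ) (hm : m < n) :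
    (∀ j, xext n x (m + 1) j ≤ xext n x m j) ∧
      ∑ j, xext n x (m + 1) j = ∑ j, xext n x m j - 1 := by
  obtain ⟨j, ⟨h1, h2⟩, -⟩ := h ⟨m, hm⟩
  simp only at h1 h2
  constructor
  · intro k
    by_cases hk : k = j
    · subst hk; omega
    · exact (h2 k hk).le
  · rw [← Finset.add_sum_erase _ _ (Finset.mem_univ j),
      ← Finset.add_sum_erase univ (xext n x m) (Finset.mem_univ j), h1,
      Finset.sum_congr rfl (fun k hk => h2 k (Finset.ne_of_mem_erase hk))]
    ring

lemma xext_anti (n : ℕ) [NeZero n] (x : Fin n → Vec n) (h : IsExtendedAlcove n x)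
    (a b : ℕ) (hab : a ≤ b) (hb : b ≤ n) (j : Fin n) : xext n x b j ≤ xext n x a j := by
  induction b, hab using Nat.le_induction with
  | base => exact le_rfl
  | succ b _ ih => exact ((xext_step n x h b (by omega)).1 j).trans (ih (by omega))

lemma xext_sum (n : ℕ) [NeZero n] (x : Fin n → Vec n) (h : IsExtendedAlcove n x)
    (b : ℕ) (hb : b ≤ n) : ∑ j, xext n x b j = ∑ j, xext n x 0 j - b := by
  induction b with
  | zero => simp
  | succ b ih =>
    rw [(xext_step n x h b (by omega)).2, ih (by omega)]
    push_cast; ring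

lemma tau_sum (g m : ℕ) (hm : m ≤ g) : ∑ j, tauAlc g m j = (g : ℤ) - m := by
  unfold tauAlc
  rw [Fin.sum_univ_eq_sum_range (fun j => if j + 1 ≤ g + m then (0 : ℤ) else 1) (2 * g),
    show 2 * g = (g + m) + (g - m) by omega, Finset.sum_range_add]
  rw [Finset.sum_eq_zero (fun k hk => by
    rw [Finset.mem_range] at hk; rw [if_pos (by omega)]),
    Finset.sum_congr rfl (fun k hk => by rw [if_neg (by omega)])]
  simp
  omega

/-- Let `0 ≤ i ≤ ⌊g/2⌋` and let `x` be an extended alcove for `GSp_{2g}` with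
`x_i = τ_i` and `x_{g-i} = τ_{g-i}`.  Then `x` is `μ`-permissible, i.e.
`ω_m ≤ x_m ≤ ω_m + (1,…,1)` and `Σ_j x_m(j) = g - m` for all `m ∈ {0,…,2g-1}`.
(These alcoves index the `i`-superspecial Kottwitz–Rapoport strata.) -/
theorem superspecial_alcove_is_permissible
    (g i : ℕ) (hg : 1 ≤ g) (hi : i ≤ g / 2) [NeZero (2 * g)]
    (x : Fin (2 * g) → Vec (2 * g)) (c : ℤ)
    (halc : IsExtendedAlcove (2 * g) x)
    (hdual : IsSympDual (2 * g) x c)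
    (hxi : x ⟨i, by omega⟩ = tauAlc g i)
    (hxgi : x ⟨g - i, by omega⟩ = tauAlc g (g - i)) :
    IsMuPermissible (2 * g) g x := by
  have key : ∀ m (hm : m < 2 * g), xext (2 * g) x m = x ⟨m, hm⟩ := fun m hm => by
    simp [xext, hm]
  have top : ∀ j, xext (2 * g) x (2 * g) j = xext (2 * g) x 0 j - 1 := fun j => by
    rw [key 0 (by omega)]; simp [xext]
  have e1 : xext (2 * g) x i = tauAlc g i := by rw [key i (by omega), hxi]
  have e2 : xext (2 * g) x (g - i) = tauAlc g (g - i) := by rw [key _ (by omega), hxgi]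
  have s0 : ∑ j, xext (2 * g) x 0 j = (g : ℤ) := by
    have h1 := xext_sum _ x halc i (by omega)
    rw [e1, tau_sum g i (by omega)] at h1
    omega
  have hc : c = 1 := by
    have h1 : ∑ j : Fin (2 * g), (xext (2 * g) x i j + xext (2 * g) x (2 * g - i) j.rev)
        = ∑ j : Fin (2 * g), (c - 1) := Finset.sum_congr rfl (fun j _ => hdual i (by omega) j)
    have h2 : ∑ j : Fin (2 * g), xext (2 * g) x (2 * g - i) j.rev
        = ∑ j : Fin (2 * g), xext (2 * g) x (2 * g - i) j :=
      Equiv.sum_comp Fin.revPerm (xext (2 * g) x (2 * g - i))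
    rw [Finset.sum_add_distrib, h2, xext_sum _ x halc i (by omega),
      xext_sum _ x halc (2 * g - i) (by omega), s0, Nat.cast_sub (by omega)] at h1
    simp only [Finset.sum_const, Finset.card_univ, Fintype.card_fin, nsmul_eq_mul] at h1
    push_cast at h1
    have h3 : (2 * (g : ℤ)) * (c - 1) = 0 := by rw [← h1]; ring
    rcases mul_eq_zero.mp h3 with h | h <;> omega
  subst hc
  intro m
  have hm := m.2
  refine ⟨fun j => ?_, ?_⟩
  · have hj := j.2
    have d1 := hdual i (by omega) j.rev
    have d2 := hdual (g - i) (by omega) j.rev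
    rw [Fin.rev_rev, e1] at d1
    rw [Fin.rev_rev, e2, show 2 * g - (g - i) = g + i by omega] at d2
    have f1 := congrFun e1 j
    have f2 := congrFun e2 j
    have t := top j
    have A := fun a b (hab : a ≤ b) (hb : b ≤ 2 * g) => xext_anti _ x halc a b hab hb j
    have B0 := A 0 m (by omega) (by omega)
    have B1 := A m (2 * g) (by omega) le_rfl
    have B2 := A 0 i (by omega) (by omega)
    have B3 := A (2 * g - i) (2 * g) (by omega) le_rfl
    have hx : xext (2 * g) x m j = x m j := by rw [key m hm]
    rw [← hx]
    simp only [tauAlc, stdAlc, Fin.val_rev] at *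
    rcases le_total (m : ℕ) i with h1 | h1
    · have := A _ _ h1 (by omega)
      constructor <;> split_ifs at * <;> omega
    have C1 := A _ _ h1 (by omega)
    rcases le_total (m : ℕ) (g - i) with h2 | h2
    · have := A _ _ h2 (by omega)
      constructor <;> split_ifs at * <;> omega
    have C2 := A _ _ h2 (by omega)
    rcases le_total (m : ℕ) (g + i) with h3 | h3
    · have := A _ _ h3 (by omega)
      constructor <;> split_ifs at * <;> omega
    have C3 := A _ _ h3 (by omega)
    rcases le_total (m : ℕ) (2 * g - i) with h4 | h4
    · have := A _ _ h4 (by omega)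
      constructor <;> split_ifs at * <;> omega
    have C4 := A _ _ h4 (by omega)
    constructor <;> split_ifs at * <;> omega
  · have h1 := xext_sum _ x halc m (by omega)
    rw [s0, key m hm] at h1
    rw [h1]; push_cast; ring
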